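/- arXiv:2211.02758 — 3 statements merged into one kernel-verified Lean document; each statement's English description precedes it below -/
import Mathlib

section
/- Well-posedness of a hierarchy of equations: Assume the operators C_{s,s+k} satisfy the growth condition with constants ρ_0,…,ρ_m ≥ 0. Then for every T with 0 < T < (Σ_{k=0}^m ρ_k e^k)^{-1} and every initial datum F_0 ∈ X_0, there exists a unique mild solution 𝐅 ∈ 𝐗_μ̄ of the hierarchy ∂_t f^(s) = Σ_{k=0}^m C_{s,s+k} f^(s+k) with 𝐅(0) = F_0; moreover ‖𝐅‖_μ̄ ≤ (1−θ)^{-1} ‖F_0‖_0, where θ := T Σ_{k=0}^m ρ_k e^k ∈ (0,1). -/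
open MeasureTheory Filter Finset

/-- The hierarchy operator `𝐂 : X → X`, `(𝐂F)^(s) := Σ_{k=0}^m C_{s,s+k} f^(s+k)`. -/
noncomputable def hierSum {X : ℕ → Type*} [∀ s, NormedAddCommGroup (X s)]
    [∀ s, NormedSpace ℝ (X s)]
    (m : ℕ) (C : ∀ s k : ℕ, X (s + k) →L[ℝ] X s) (F : ∀ s, X s) : ∀ s, X s :=
  fun s => ∑ k ∈ Finset.range (m + 1), C s k (F (s + k))

/-- `F` is a mild solution on `[0,T]` of the hierarchy `∂_t f^(s) = Σ_{k=0}^m C_{s,s+k} f^(s+k)`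
with initial datum `F₀`. -/
noncomputable def IsMildSolution {X : ℕ → Type*} [∀ s, NormedAddCommGroup (X s)]
    [∀ s, NormedSpace ℝ (X s)]
    (m : ℕ) (C : ∀ s k : ℕ, X (s + k) →L[ℝ] X s) (T : ℝ) (F₀ : ∀ s, X s)
    (F : ℝ → ∀ s, X s) : Prop :=
  (∀ s : ℕ, ∀ t ∈ Set.Icc (0 : ℝ) T,
      IntegrableOn (fun τ => hierSum m C (F τ) s) (Set.Icc 0 t) volume) ∧
  ∀ t ∈ Set.Icc (0 : ℝ) T, ∀ s : ℕ,
      F t s = F₀ s + ∫ τ in Set.Icc (0 : ℝ) t, hierSum m C (F τ) s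

/-- `F ∈ 𝐗_μ̄`: the time-dependent sequence is uniformly bounded with the weight
`μ̄(t) = −t/T`. -/
def MemXmuBar {X : ℕ → Type*} [∀ s, NormedAddCommGroup (X s)] (T : ℝ)
    (F : ℝ → ∀ s, X s) : Prop :=
  ∃ B : ℝ, ∀ t ∈ Set.Icc (0 : ℝ) T, ∀ s : ℕ, Real.exp ((-t / T) * s) * ‖F t s‖ ≤ B

/-- Pointwise weak convergence of sequences in `X = ⊕_s X^(s)`. -/
def PWConv {X : ℕ → Type*} [∀ s, NormedAddCommGroup (X s)] [∀ s, NormedSpace ℝ (X s)]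
    (FN : ℕ → ∀ s, X s) (F : ∀ s, X s) : Prop :=
  ∀ s : ℕ, ∀ φ : X s →L[ℝ] ℝ,
    Tendsto (fun N => φ (FN N s)) atTop (nhds (φ (F s)))

section Hierarchy

variable {X : ℕ → Type*} [∀ s, NormedAddCommGroup (X s)] [∀ s, NormedSpace ℝ (X s)]

lemma norm_hierSum_le {m : ℕ} {C : ∀ s k : ℕ, X (s + k) →L[ℝ] X s} {ρ : ℕ → ℝ}
    (hρ : ∀ k, 0 ≤ ρ k)
    (hgrow : ∀ s : ℕ, ∀ k ≤ m, ∀ f : X (s + k), ‖C s k f‖ ≤ ρ k * s * ‖f‖)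
    {T : ℝ} (hT0 : 0 < T) {B : ℝ} (hB : 0 ≤ B) {t : ℝ} (ht : t ≤ T) {F : ∀ s, X s}
    (hF : ∀ s : ℕ, ‖F s‖ ≤ B * Real.exp (t / T * s)) (s : ℕ) :
    ‖hierSum m C F s‖ ≤
      (∑ k ∈ range (m + 1), ρ k * Real.exp k) * B * (s * Real.exp (t / T * s)) := by
  unfold hierSum
  rw [sum_mul, sum_mul]
  refine norm_sum_le_of_le _ fun k hk => ?_
  have htT : t / T ≤ 1 := (div_le_one hT0).2 ht
  have hexp : Real.exp (t / T * (s + k : ℕ)) ≤ Real.exp k * Real.exp (t / T * s) := by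
    rw [← Real.exp_add, Real.exp_le_exp]
    push_cast
    nlinarith [mul_le_mul_of_nonneg_right htT (Nat.cast_nonneg (α := ℝ) k)]
  have hρs : 0 ≤ ρ k * s := mul_nonneg (hρ k) s.cast_nonneg
  calc ‖C s k (F (s + k))‖ ≤ ρ k * s * ‖F (s + k)‖ :=
        hgrow s k (Nat.lt_succ_iff.1 (mem_range.1 hk)) _
    _ ≤ ρ k * s * (B * (Real.exp k * Real.exp (t / T * s))) := by
        gcongr
        exact (hF _).trans (by gcongr)
    _ = _ := by ring

lemma integral_nat_mul_exp_le {T : ℝ} (hT0 : 0 < T) (s : ℕ) (t : ℝ) :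
    ∫ τ in (0 : ℝ)..t, (s * Real.exp (τ / T * s)) ≤ T * Real.exp (t / T * s) := by
  have hderiv : ∀ τ ∈ Set.uIcc 0 t,
      HasDerivAt (fun τ => T * Real.exp (τ / T * s)) (s * Real.exp (τ / T * s)) τ := by
    intro τ _
    have h := ((((hasDerivAt_id' τ).div_const T).mul_const (s : ℝ)).exp.const_mul T)
    refine h.congr_deriv ?_
    field_simp
  rw [intervalIntegral.integral_eq_sub_of_hasDerivAt hderiv
    (Continuous.intervalIntegrable (by fun_prop) _ _)]
  have := mul_pos hT0 (Real.exp_pos (0 / T * s))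
  linarith

lemma norm_integral_hierSum_le {m : ℕ} {C : ∀ s k : ℕ, X (s + k) →L[ℝ] X s} {ρ : ℕ → ℝ}
    (hρ : ∀ k, 0 ≤ ρ k)
    (hgrow : ∀ s : ℕ, ∀ k ≤ m, ∀ f : X (s + k), ‖C s k f‖ ≤ ρ k * s * ‖f‖)
    {T : ℝ} (hT0 : 0 < T) {B : ℝ} (hB : 0 ≤ B) {F : ℝ → ∀ s, X s}
    (hF : ∀ t ∈ Set.Icc 0 T, ∀ s : ℕ, ‖F t s‖ ≤ B * Real.exp (t / T * s))
    {t : ℝ} (ht : t ∈ Set.Icc 0 T) (s : ℕ) :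
    ‖∫ τ in (0 : ℝ)..t, hierSum m C (F τ) s‖ ≤
      (T * ∑ k ∈ range (m + 1), ρ k * Real.exp k) * B * Real.exp (t / T * s) := by
  set S := ∑ k ∈ range (m + 1), ρ k * Real.exp k
  have hS0 : 0 ≤ S := sum_nonneg fun k _ => mul_nonneg (hρ k) (Real.exp_pos _).le
  calc ‖∫ τ in (0 : ℝ)..t, hierSum m C (F τ) s‖
      ≤ ∫ τ in (0 : ℝ)..t, S * B * (s * Real.exp (τ / T * s)) := by
        refine intervalIntegral.norm_integral_le_of_norm_le ht.1
          (Eventually.of_forall fun τ hτ => ?_)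
          (Continuous.intervalIntegrable (by fun_prop) _ _)
        have hτT := hτ.2.trans ht.2
        exact norm_hierSum_le hρ hgrow hT0 hB hτT (hF τ ⟨hτ.1.le, hτT⟩) s
    _ = S * B * ∫ τ in (0 : ℝ)..t, (s * Real.exp (τ / T * s)) :=
        intervalIntegral.integral_const_mul _ _
    _ ≤ S * B * (T * Real.exp (t / T * s)) := by
        gcongr
        exact integral_nat_mul_exp_le hT0 s t
    _ = _ := by ring

/-- Iterated Duhamel integrals of the initial datum: the terms of the Picard series. -/
noncomputable def duhamelTerm (m : ℕ) (C : ∀ s k : ℕ, X (s + k) →L[ℝ] X s) (F₀ : ∀ s, X s) :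
    ℕ → ℝ → ∀ s, X s
  | 0 => fun _ => F₀
  | n + 1 => fun t s => ∫ τ in (0 : ℝ)..t, hierSum m C (duhamelTerm m C F₀ n τ) s

lemma continuousOn_hierSum {m : ℕ} {C : ∀ s k : ℕ, X (s + k) →L[ℝ] X s} {F : ℝ → ∀ s, X s}
    {I : Set ℝ} (hF : ∀ s, ContinuousOn (fun t => F t s) I) (s : ℕ) :
    ContinuousOn (fun t => hierSum m C (F t) s) I :=
  continuousOn_finsetSum _ fun k _ => (C s k).continuous.comp_continuousOn (hF (s + k))

lemma continuous_duhamelTerm (m : ℕ) (C : ∀ s k : ℕ, X (s + k) →L[ℝ] X s) (F₀ : ∀ s, X s)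
    (n s : ℕ) : Continuous fun t => duhamelTerm m C F₀ n t s := by
  induction n generalizing s with
  | zero => exact continuous_const
  | succ n ih =>
    have hcont : Continuous fun t => hierSum m C (duhamelTerm m C F₀ n t) s :=
      continuousOn_univ.1 (continuousOn_hierSum (fun s => (ih s).continuousOn) s)
    exact intervalIntegral.continuous_primitive (fun _ _ => hcont.intervalIntegrable _ _) 0

lemma norm_duhamelTerm_le {m : ℕ} {C : ∀ s k : ℕ, X (s + k) →L[ℝ] X s} {ρ : ℕ → ℝ}
    (hρ : ∀ k, 0 ≤ ρ k)
    (hgrow : ∀ s : ℕ, ∀ k ≤ m, ∀ f : X (s + k), ‖C s k f‖ ≤ ρ k * s * ‖f‖)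
    {T : ℝ} (hT0 : 0 < T) {A : ℝ} {F₀ : ∀ s, X s} (hF₀ : ∀ s, ‖F₀ s‖ ≤ A)
    (n : ℕ) {t : ℝ} (ht : t ∈ Set.Icc 0 T) (s : ℕ) :
    ‖duhamelTerm m C F₀ n t s‖ ≤
      (T * ∑ k ∈ range (m + 1), ρ k * Real.exp k) ^ n * A * Real.exp (t / T * s) := by
  have hA : 0 ≤ A := (norm_nonneg _).trans (hF₀ 0)
  have hθ : 0 ≤ T * ∑ k ∈ range (m + 1), ρ k * Real.exp k :=
    mul_nonneg hT0.le (sum_nonneg fun k _ => mul_nonneg (hρ k) (Real.exp_pos _).le)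
  induction n generalizing t s with
  | zero =>
    have : 1 ≤ Real.exp (t / T * s) :=
      Real.one_le_exp (mul_nonneg (div_nonneg ht.1 hT0.le) s.cast_nonneg)
    simpa [duhamelTerm] using (hF₀ s).trans (le_mul_of_one_le_right hA this)
  | succ n ih =>
    have := norm_integral_hierSum_le hρ hgrow hT0 (mul_nonneg (pow_nonneg hθ n) hA)
      (fun t ht s => ih ht s) ht s
    rwa [← mul_assoc, ← pow_succ'] at this

lemma weighted_norm_le_iff {E : Type*} [NormedAddCommGroup E] (t T B : ℝ) (s : ℕ) (f : E) :
    Real.exp ((-t / T) * s) * ‖f‖ ≤ B ↔ ‖f‖ ≤ B * Real.exp (t / T * s) := by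
  rw [neg_div, neg_mul, Real.exp_neg, inv_mul_le_iff₀ (Real.exp_pos _), mul_comm B]

lemma setIntegral_Icc_zero_eq {E : Type*} [NormedAddCommGroup E] [NormedSpace ℝ E]
    (f : ℝ → E) {t : ℝ} (ht : 0 ≤ t) :
    ∫ τ in Set.Icc (0 : ℝ) t, f τ = ∫ τ in (0 : ℝ)..t, f τ := by
  rw [integral_Icc_eq_integral_Ioc, intervalIntegral.integral_of_le ht]

lemma hierSum_sub (m : ℕ) (C : ∀ s k : ℕ, X (s + k) →L[ℝ] X s) (F G : ∀ s, X s) (s : ℕ) :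
    hierSum m C (F - G) s = hierSum m C F s - hierSum m C G s := by
  simp [hierSum, sum_sub_distrib]

lemma IsMildSolution.eq_of_memXmuBar {m : ℕ} {C : ∀ s k : ℕ, X (s + k) →L[ℝ] X s} {ρ : ℕ → ℝ}
    (hρ : ∀ k, 0 ≤ ρ k)
    (hgrow : ∀ s : ℕ, ∀ k ≤ m, ∀ f : X (s + k), ‖C s k f‖ ≤ ρ k * s * ‖f‖)
    {T : ℝ} (hT0 : 0 < T) (hθ : T * ∑ k ∈ range (m + 1), ρ k * Real.exp k < 1)
    {F₀ : ∀ s, X s} {F G : ℝ → ∀ s, X s} (hF : MemXmuBar T F) (hG : MemXmuBar T G)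
    (hFsol : IsMildSolution m C T F₀ F) (hGsol : IsMildSolution m C T F₀ G)
    {t : ℝ} (ht : t ∈ Set.Icc 0 T) : G t = F t := by
  set θ := T * ∑ k ∈ range (m + 1), ρ k * Real.exp k
  have hθ0 : 0 ≤ θ :=
    mul_nonneg hT0.le (sum_nonneg fun k _ => mul_nonneg (hρ k) (Real.exp_pos _).le)
  obtain ⟨A, hA⟩ := hF
  obtain ⟨B, hB⟩ := hG
  simp only [weighted_norm_le_iff] at hA hB
  have hAB : 0 ≤ A + B := by
    have h1 := (norm_nonneg _).trans (hA 0 ⟨le_rfl, hT0.le⟩ 0)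
    have h2 := (norm_nonneg _).trans (hB 0 ⟨le_rfl, hT0.le⟩ 0)
    simp only [Nat.cast_zero, mul_zero, Real.exp_zero, mul_one] at h1 h2
    exact add_nonneg h1 h2
  have hdiff : ∀ t ∈ Set.Icc 0 T, ∀ s,
      (G t - F t) s = ∫ τ in (0 : ℝ)..t, hierSum m C (G τ - F τ) s := by
    intro t ht s
    simp only [hierSum_sub]
    rw [Pi.sub_apply, hGsol.2 t ht s, hFsol.2 t ht s, add_sub_add_left_eq_sub,
      ← integral_sub (hGsol.1 s t ht) (hFsol.1 s t ht), setIntegral_Icc_zero_eq _ ht.1]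
  have hbound : ∀ n : ℕ, ∀ t ∈ Set.Icc 0 T, ∀ s : ℕ,
      ‖(G t - F t) s‖ ≤ θ ^ n * (A + B) * Real.exp (t / T * s) := by
    intro n
    induction n with
    | zero =>
      intro t ht s
      rw [pow_zero, one_mul, add_mul, add_comm]
      exact (norm_sub_le _ _).trans (add_le_add (hB t ht s) (hA t ht s))
    | succ n ih =>
      intro t ht s
      have := norm_integral_hierSum_le (F := fun t => G t - F t) hρ hgrow hT0
        (mul_nonneg (pow_nonneg hθ0 n) hAB) ih ht s
      rwa [← hdiff t ht s, ← mul_assoc, ← pow_succ'] at this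
  have hlim : ∀ s : ℕ, Tendsto (fun n => θ ^ n * (A + B) * Real.exp (t / T * s)) atTop
      (nhds 0) := fun s => by
    simpa using ((tendsto_pow_atTop_nhds_zero_of_lt_one hθ0 hθ).mul_const (A + B)).mul_const
      (Real.exp (t / T * s))
  funext s
  have := ge_of_tendsto' (hlim s) fun n => hbound n t ht s
  exact sub_eq_zero.1 (norm_le_zero_iff.1 this)

lemma hasSum_hierSum (m : ℕ) (C : ∀ s k : ℕ, X (s + k) →L[ℝ] X s) {D : ℕ → ∀ s, X s}
    {F : ∀ s, X s} (h : ∀ s, HasSum (fun n => D n s) (F s)) (s : ℕ) :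
    HasSum (fun n => hierSum m C (D n) s) (hierSum m C F s) :=
  hasSum_sum fun k _ => (C s k).hasSum (h (s + k))

end Hierarchy

/-- **Well-posedness of a hierarchy of equations.** If the operators `C_{s,s+k}` satisfy the
growth condition with constants `ρ_0,…,ρ_m ≥ 0`, then for every `0 < T < (Σ_k ρ_k e^k)⁻¹` and
every `F₀ ∈ X_0` there is a unique mild solution `F ∈ 𝐗_μ̄` of the hierarchy with `F(0) = F₀`,
and it satisfies `‖F‖_μ̄ ≤ (1 − θ)⁻¹ ‖F₀‖_0` with `θ = T Σ_k ρ_k e^k`. -/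
theorem stmt0 {X : ℕ → Type*} [∀ s, NormedAddCommGroup (X s)] [∀ s, NormedSpace ℝ (X s)]
    [∀ s, CompleteSpace (X s)]
    (m : ℕ) (C : ∀ s k : ℕ, X (s + k) →L[ℝ] X s)
    (ρ : ℕ → ℝ) (hρ : ∀ k, 0 ≤ ρ k)
    (hgrow : ∀ s : ℕ, ∀ k ≤ m, ∀ f : X (s + k), ‖C s k f‖ ≤ ρ k * s * ‖f‖)
    (T : ℝ) (hT0 : 0 < T)
    (hT : T < (∑ k ∈ Finset.range (m + 1), ρ k * Real.exp k)⁻¹)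
    (F₀ : ∀ s, X s) (hF₀ : BddAbove (Set.range fun s => ‖F₀ s‖)) :
    ∃ F : ℝ → ∀ s, X s,
      MemXmuBar T F ∧ IsMildSolution m C T F₀ F ∧
      (∀ t ∈ Set.Icc (0 : ℝ) T, ∀ s : ℕ,
        Real.exp ((-t / T) * s) * ‖F t s‖ ≤
          (1 - T * ∑ k ∈ Finset.range (m + 1), ρ k * Real.exp k)⁻¹ * (⨆ s : ℕ, ‖F₀ s‖)) ∧
      ∀ G : ℝ → ∀ s, X s, MemXmuBar T G → IsMildSolution m C T F₀ G →
        ∀ t ∈ Set.Icc (0 : ℝ) T, G t = F t := by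
  set S := ∑ k ∈ Finset.range (m + 1), ρ k * Real.exp k
  have hS0 : 0 ≤ S := sum_nonneg fun k _ => mul_nonneg (hρ k) (Real.exp_pos _).le
  have hSpos : 0 < S := inv_pos.1 (hT0.trans hT)
  have hθ : T * S < 1 := (lt_inv_mul_iff₀' hSpos).1 (by simpa using hT)
  have hθ0 : 0 ≤ T * S := mul_nonneg hT0.le hS0
  set A := ⨆ s : ℕ, ‖F₀ s‖
  have hA : ∀ s, ‖F₀ s‖ ≤ A := le_ciSup hF₀
  have hA0 : 0 ≤ A := (norm_nonneg _).trans (hA 0)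
  set D := duhamelTerm m C F₀ with hDdef
  have hD : ∀ n : ℕ, ∀ t ∈ Set.Icc 0 T, ∀ s : ℕ,
      ‖D n t s‖ ≤ (T * S) ^ n * A * Real.exp (t / T * s) :=
    fun n t ht s => norm_duhamelTerm_le hρ hgrow hT0 hA n ht s
  have hgeom : ∀ c : ℝ, HasSum (fun n => (T * S) ^ n * A * c) ((1 - T * S)⁻¹ * A * c) :=
    fun c => ((hasSum_geometric_of_lt_one hθ0 hθ).mul_right A).mul_right c
  let F : ℝ → ∀ s, X s := fun t s => ∑' n, D n t s
  have hsum : ∀ t ∈ Set.Icc 0 T, ∀ s, HasSum (fun n => D n t s) (F t s) :=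
    fun t ht s => (Summable.of_norm_bounded (hgeom _).summable fun n => hD n t ht s).hasSum
  have hFbound : ∀ t ∈ Set.Icc 0 T, ∀ s : ℕ,
      Real.exp ((-t / T) * s) * ‖F t s‖ ≤ (1 - T * S)⁻¹ * A := fun t ht s =>
    (weighted_norm_le_iff _ _ _ _ _).2
      (tsum_of_norm_bounded (hgeom _) fun n => hD n t ht s)
  have hFcont : ∀ s, ContinuousOn (fun t => F t s) (Set.Icc 0 T) := by
    intro s
    refine continuousOn_tsum (fun n => (continuous_duhamelTerm m C F₀ n s).continuousOn)
      (hgeom (Real.exp s)).summable fun n t ht => (hD n t ht s).trans ?_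
    have : t / T * s ≤ s :=
      mul_le_of_le_one_left s.cast_nonneg ((div_le_one hT0).2 ht.2)
    gcongr
  have hFsol : IsMildSolution m C T F₀ F := by
    refine ⟨fun s t ht => ((continuousOn_hierSum hFcont s).mono
      (Set.Icc_subset_Icc_right ht.2)).integrableOn_Icc, fun t ht s => ?_⟩
    rw [setIntegral_Icc_zero_eq _ ht.1]
    have hint : HasSum (fun n => D (n + 1) t s) (∫ τ in (0 : ℝ)..t, hierSum m C (F τ) s) := by
      have hmem : ∀ τ ∈ Set.uIoc 0 t, τ ∈ Set.Icc 0 T := fun τ hτ => by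
        rw [Set.uIoc_of_le ht.1] at hτ
        exact ⟨hτ.1.le, hτ.2.trans ht.2⟩
      refine intervalIntegral.hasSum_integral_of_dominated_convergence
        (fun n τ => (T * S) ^ n * A * (S * (s * Real.exp (τ / T * s))))
        (fun n => ?_) (fun n => Eventually.of_forall fun τ hτ => ?_)
        (Eventually.of_forall fun τ _ => (hgeom _).summable) ?_
        (Eventually.of_forall fun τ hτ => hasSum_hierSum m C (hsum τ (hmem τ hτ)) s)
      · exact (continuousOn_univ.1 (continuousOn_hierSum (fun s =>
          (continuous_duhamelTerm m C F₀ n s).continuousOn) s)).aestronglyMeasurable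
      · refine (norm_hierSum_le hρ hgrow hT0 (mul_nonneg (pow_nonneg hθ0 n) hA0)
          (hmem τ hτ).2 (hD n τ (hmem τ hτ)) s).trans_eq ?_
        ring
      · simp only [fun τ : ℝ => (hgeom (S * (s * Real.exp (τ / T * s)))).tsum_eq]
        exact Continuous.intervalIntegrable (by fun_prop) _ _
    exact (hsum t ht s).unique ((hasSum_nat_add_iff' 1).1
      (by simpa [hDdef, duhamelTerm] using hint))
  exact ⟨F, ⟨_, hFbound⟩, hFsol, hFbound, fun G hG hGsol t ht =>
    hFsol.eq_of_memXmuBar hρ hgrow hT0 hθ ⟨_, hFbound⟩ hG hGsol ht⟩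
end

section
/- Quantitative bound on powers of a hierarchy operator: Assume the operators C_{s,s+k} satisfy the growth condition with constants ρ_0,…,ρ_m, and set T_* := (Σ_{k=0}^m ρ_k e^k)^{-1}. Then for every s ∈ ℕ, every μ ≥ −1, every integer n ≥ 10 and every F ∈ X_μ, one has ‖π_s[(𝐂)^n F]‖_{X^(s)} ≤ s·e^{−μs}·n!·(m/T_*)^n·(e·n)^{s/m}·‖F‖_μ, where π_s F denotes the s-th component of F. -/
open MeasureTheory Filter Finset

/-- Iterating the growth condition: each application of the hierarchy operator costs a factor
`∑ ρ_k e^k`, and the particle numbers met along the way are at most `s, s + m, s + 2m, …`. -/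
theorem norm_iterate_hierSum_le {X : ℕ → Type*} [∀ s, NormedAddCommGroup (X s)]
    [∀ s, NormedSpace ℝ (X s)] (m : ℕ) (C : ∀ s k : ℕ, X (s + k) →L[ℝ] X s)
    (ρ : ℕ → ℝ) (hρ : ∀ k, 0 ≤ ρ k)
    (hgrow : ∀ s : ℕ, ∀ k ≤ m, ∀ f : X (s + k), ‖C s k f‖ ≤ ρ k * s * ‖f‖)
    (μ : ℝ) (hμ : -1 ≤ μ) (F : ∀ s, X s) (M : ℝ) (hM : 0 ≤ M)
    (hF : ∀ r : ℕ, ‖F r‖ ≤ Real.exp (-μ * r) * M) (n s : ℕ) :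
    ‖(fun G => hierSum m C G)^[n] F s‖ ≤
      Real.exp (-μ * s) * (∑ k ∈ Finset.range (m + 1), ρ k * Real.exp k) ^ n *
        (∏ j ∈ Finset.range n, ((s : ℝ) + j * m)) * M := by
  set S := ∑ k ∈ Finset.range (m + 1), ρ k * Real.exp k
  have hS0 : 0 ≤ S := Finset.sum_nonneg fun k _ => mul_nonneg (hρ k) (Real.exp_pos _).le
  induction n generalizing s with
  | zero => simpa using hF s
  | succ n ih =>
    rw [Function.iterate_succ_apply']
    set P : ℝ := ∏ j ∈ Finset.range n, ((s : ℝ) + (j + 1) * m) with hP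
    have hP0 : 0 ≤ P := Finset.prod_nonneg fun j _ => by positivity
    have hterm : ∀ k ∈ Finset.range (m + 1),
        ‖C s k ((fun G => hierSum m C G)^[n] F (s + k))‖ ≤
          (ρ k * Real.exp k) * (s * (Real.exp (-μ * s) * S ^ n * P * M)) := by
      intro k hk
      have hkm : k ≤ m := by
        have := Finset.mem_range.mp hk
        omega
      have hkm' : (k : ℝ) ≤ m := by exact_mod_cast hkm
      have hprod : ∏ j ∈ Finset.range n, (((s + k : ℕ) : ℝ) + j * m) ≤ P := by
        refine Finset.prod_le_prod (fun j _ => by positivity) fun j _ => ?_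
        push_cast
        linarith
      have hexp : Real.exp (-μ * (s + k : ℕ)) ≤ Real.exp k * Real.exp (-μ * s) := by
        rw [← Real.exp_add]
        refine Real.exp_le_exp.mpr ?_
        push_cast
        nlinarith [(Nat.cast_nonneg k : (0 : ℝ) ≤ k)]
      have hρk := hρ k
      calc _ ≤ ρ k * s * ‖(fun G => hierSum m C G)^[n] F (s + k)‖ := hgrow s k hkm _
        _ ≤ ρ k * s * (Real.exp (-μ * (s + k : ℕ)) * S ^ n *
              (∏ j ∈ Finset.range n, (((s + k : ℕ) : ℝ) + j * m)) * M) := by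
            gcongr
            exact ih (s + k)
        _ ≤ ρ k * s * ((Real.exp k * Real.exp (-μ * s)) * S ^ n * P * M) := by
            gcongr
        _ = _ := by ring
    calc _ ≤ ∑ k ∈ Finset.range (m + 1),
            (ρ k * Real.exp k) * (s * (Real.exp (-μ * s) * S ^ n * P * M)) :=
          norm_sum_le_of_le _ hterm
      _ = S * (s * (Real.exp (-μ * s) * S ^ n * P * M)) := by rw [← Finset.sum_mul]
      _ = _ := by
          rw [Finset.prod_range_succ', hP]
          push_cast
          ring

/-- `∏_{j=1}^p (s + j m) ≤ m^p p! exp ((s/m) H_p)`. -/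
theorem prod_add_mul_le_exp_harmonic (m : ℕ) (hm : 0 < m) (s p : ℕ) :
    ∏ j ∈ Finset.range p, ((s : ℝ) + (j + 1) * m) ≤
      (m : ℝ) ^ p * p.factorial * Real.exp ((s : ℝ) / m * (harmonic p : ℝ)) := by
  induction p with
  | zero => simp
  | succ p ih =>
    have hm' : (0 : ℝ) < m := by exact_mod_cast hm
    have hfac : (s : ℝ) + (p + 1) * m ≤
        m * (p + 1) * Real.exp ((s : ℝ) / m * ((p : ℝ) + 1)⁻¹) := by
      have h := Real.add_one_le_exp ((s : ℝ) / m * ((p : ℝ) + 1)⁻¹)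
      calc (s : ℝ) + (p + 1) * m = m * (p + 1) * ((s : ℝ) / m * ((p : ℝ) + 1)⁻¹ + 1) := by
            field_simp
        _ ≤ _ := by gcongr
    rw [Finset.prod_range_succ, harmonic_succ, Nat.factorial_succ]
    calc _ ≤ ((m : ℝ) ^ p * p.factorial * Real.exp ((s : ℝ) / m * (harmonic p : ℝ))) *
            (m * (p + 1) * Real.exp ((s : ℝ) / m * ((p : ℝ) + 1)⁻¹)) := by gcongr
      _ = _ := by
          push_cast
          rw [mul_add ((s : ℝ) / m), Real.exp_add]
          ring

theorem prod_add_mul_le_factorial_mul_rpow (m : ℕ) (hm : 0 < m) (s n : ℕ) (hn : 0 < n) :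
    ∏ j ∈ Finset.range n, ((s : ℝ) + j * m) ≤
      s * (n.factorial : ℝ) * (m : ℝ) ^ n *
        (Real.exp 1 * (n : ℝ)) ^ ((s : ℝ) / (m : ℝ)) := by
  obtain ⟨p, rfl⟩ : ∃ p, n = p + 1 := ⟨n - 1, by omega⟩
  have hm' : (1 : ℝ) ≤ m := by exact_mod_cast hm
  have hn' : (0 : ℝ) < ((p + 1 : ℕ) : ℝ) := by positivity
  have hharm : (harmonic p : ℝ) ≤ 1 + Real.log ((p + 1 : ℕ) : ℝ) := by
    refine le_trans ?_ (harmonic_le_one_add_log (p + 1))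
    rw [harmonic_succ]
    push_cast
    have : (0 : ℝ) ≤ ((p : ℝ) + 1)⁻¹ := by positivity
    linarith
  have hexp : Real.exp ((s : ℝ) / m * (harmonic p : ℝ)) ≤
      (Real.exp 1 * ((p + 1 : ℕ) : ℝ)) ^ ((s : ℝ) / (m : ℝ)) := by
    rw [Real.rpow_def_of_pos (by positivity), Real.log_mul (Real.exp_pos 1).ne' hn'.ne',
      Real.log_exp, mul_comm]
    gcongr
  have hfac : (p.factorial : ℝ) ≤ ((p + 1).factorial : ℝ) := by
    exact_mod_cast Nat.factorial_le p.le_succ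
  have hpow : (m : ℝ) ^ p ≤ (m : ℝ) ^ (p + 1) := pow_le_pow_right₀ hm' p.le_succ
  have hprod := prod_add_mul_le_exp_harmonic m hm s p
  rw [Finset.prod_range_succ']
  calc _ = (∏ j ∈ Finset.range p, ((s : ℝ) + (j + 1) * m)) * s := by
        push_cast
        ring
    _ ≤ ((m : ℝ) ^ (p + 1) * (p + 1).factorial *
          (Real.exp 1 * ((p + 1 : ℕ) : ℝ)) ^ ((s : ℝ) / (m : ℝ))) * s := by
        gcongr
        exact hprod.trans (by gcongr)
    _ = _ := by ring

/-- **Quantitative bound on powers of a hierarchy operator** (Lemma 5.2 of the paper). With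
`T_* = (Σ_k ρ_k e^k)⁻¹`, for every `s ∈ ℕ`, `μ ≥ −1`, `n ≥ 10` and `F ∈ X_μ`,
`‖π_s[(𝐂)^n F]‖ ≤ s e^{−μs} n! (m/T_*)^n (e n)^{s/m} ‖F‖_μ`. -/
theorem stmt3 {X : ℕ → Type*} [∀ s, NormedAddCommGroup (X s)] [∀ s, NormedSpace ℝ (X s)]
    (m : ℕ) (hm : 0 < m) (C : ∀ s k : ℕ, X (s + k) →L[ℝ] X s)
    (ρ : ℕ → ℝ) (hρ : ∀ k, 0 ≤ ρ k)
    (hgrow : ∀ s : ℕ, ∀ k ≤ m, ∀ f : X (s + k), ‖C s k f‖ ≤ ρ k * s * ‖f‖)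
    (s : ℕ) (μ : ℝ) (hμ : -1 ≤ μ) (n : ℕ) (hn : 10 ≤ n)
    (F : ∀ s, X s) (hF : BddAbove (Set.range fun r : ℕ => Real.exp (μ * r) * ‖F r‖)) :
    ‖(fun G => hierSum m C G)^[n] F s‖ ≤
      (s : ℝ) * Real.exp (-μ * s) * (n.factorial : ℝ) *
        ((m : ℝ) / (∑ k ∈ Finset.range (m + 1), ρ k * Real.exp k)⁻¹) ^ n *
        (Real.exp 1 * (n : ℝ)) ^ ((s : ℝ) / (m : ℝ)) *
        (⨆ r : ℕ, Real.exp (μ * r) * ‖F r‖) := by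
  set M := ⨆ r : ℕ, Real.exp (μ * r) * ‖F r‖
  have hle : ∀ r : ℕ, Real.exp (μ * r) * ‖F r‖ ≤ M := fun r => le_ciSup hF r
  have hM : 0 ≤ M := le_trans (by positivity) (hle 0)
  have hFM : ∀ r : ℕ, ‖F r‖ ≤ Real.exp (-μ * r) * M := by
    intro r
    calc ‖F r‖ = Real.exp (-μ * r) * (Real.exp (μ * r) * ‖F r‖) := by
          rw [← mul_assoc, ← Real.exp_add]
          simp
      _ ≤ _ := by
          gcongr
          exact hle r
  have hS0 : 0 ≤ ∑ k ∈ Finset.range (m + 1), ρ k * Real.exp k :=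
    Finset.sum_nonneg fun k _ => mul_nonneg (hρ k) (Real.exp_pos _).le
  refine (norm_iterate_hierSum_le m C ρ hρ hgrow μ hμ F M hM hFM n s).trans ?_
  have hprod := prod_add_mul_le_factorial_mul_rpow m hm s n (by omega)
  rw [div_inv_eq_mul, mul_pow]
  refine (mul_le_mul_of_nonneg_right (mul_le_mul_of_nonneg_left hprod
    (mul_nonneg (Real.exp_pos _).le (pow_nonneg hS0 n))) hM).trans_eq ?_
  ring
end

section
/- Trace identity for the collision generators: Let 1 ≤ n ≤ K ≤ M, set r := K−n, and assume s + r ≤ N. Let the indices satisfy 1 ≤ i_1 < ⋯ < i_n ≤ s < i_{n+1} < ⋯ < i_K ≤ N. Then for every f ∈ L^1_sym(ℝ^{dN}), Tr_{s+1,…,N}(Ω_{i_1⋯i_K} f) = C^{s,K,n}_{i_1⋯i_n}[ Tr_{s+r+1,…,N} f ], where Tr_{j+1,…,N} g (V_j) := ∫_{ℝ^{d(N−j)}} g(V_j, v_{j+1},…,v_N) dv_{j+1}⋯dv_N and Ω_{i_1⋯i_K} f := ∫_{S_K} ( f∘T^ω_{i_1⋯i_K} − f ) db_K(ω). In particular the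 left-hand side does not depend on the indices i_{n+1},…,i_K. -/
open MeasureTheory Filter Finset
open scoped Classical

noncomputable section

/-- The single-particle velocity space `ℝ^d`. -/
abbrev ESp (d : ℕ) := EuclideanSpace ℝ (Fin d)

/-- Action of a permutation of `{1,…,K}` on `ℝ^{dK}`, permuting the `K` blocks of `ℝ^d`:
`σ(V)_i = V_{σ(i)}`. -/
def permAct {d K : ℕ} (σ : Equiv.Perm (Fin K)) (V : Fin K → ESp d) : Fin K → ESp d :=
  fun i => V (σ i)

/-- `f` is invariant under permutations of its `n` blocks of `d` variables. -/
def SymFun {d n : ℕ} (f : (Fin n → ESp d) → ℝ) : Prop :=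
  ∀ σ : Equiv.Perm (Fin n), ∀ V : Fin n → ESp d, f (fun j => V (σ j)) = f V

/-- Extension `T^ω_{i_1⋯i_K}` of a `K`-particle map to `N` particles: the particles labelled by
`ι` collide according to `Tω`, the others are untouched. -/
def extendMap {d K N : ℕ} (Tω : (Fin K → ESp d) → Fin K → ESp d)
    (ι : Fin K → Fin N) (V : Fin N → ESp d) : Fin N → ESp d :=
  fun j => if h : ∃ a, ι a = j then Tω (fun a => V (ι a)) h.choose else V j

/-- **(H1)**: each `T_K^ω` conserves kinetic energy (is an isometry of `ℝ^{dK}`). -/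
def KacH1 (d M : ℕ) (S : ℕ → Type*)
    (T : ∀ K, S K → (Fin K → ESp d) ≃ₗ[ℝ] (Fin K → ESp d)) : Prop :=
  ∀ K, 1 ≤ K → K ≤ M → ∀ ω : S K, ∀ V : Fin K → ESp d,
    ∑ i : Fin K, ‖T K ω V i‖ ^ 2 = ∑ i : Fin K, ‖V i‖ ^ 2

/-- **(H2)**: on average over the collision kernel, `T_K` is an involution. -/
def KacH2 (d M : ℕ) (S : ℕ → Type*) [∀ K, MeasurableSpace (S K)]
    (b : ∀ K, Measure (S K))
    (T : ∀ K, S K → (Fin K → ESp d) ≃ₗ[ℝ] (Fin K → ESp d)) : Prop :=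
  ∀ K, 1 ≤ K → K ≤ M → ∀ φ : (Fin K → ESp d) → ℝ, Continuous φ →
    ∀ V : Fin K → ESp d,
      ∫ ω, φ ((T K ω).symm V) ∂(b K) = ∫ ω, φ (T K ω V) ∂(b K)

/-- **(H3)**: on average over the collision kernel, `T_K` is invariant under relabelling of the
particles: `∫ φ((σ∘T_K^ω∘σ⁻¹)V) db_K = ∫ φ(T_K^ω V) db_K`. -/
def KacH3 (d M : ℕ) (S : ℕ → Type*) [∀ K, MeasurableSpace (S K)]
    (b : ∀ K, Measure (S K))
    (T : ∀ K, S K → (Fin K → ESp d) ≃ₗ[ℝ] (Fin K → ESp d)) : Prop :=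
  ∀ K, 1 ≤ K → K ≤ M → ∀ σ : Equiv.Perm (Fin K), ∀ φ : (Fin K → ESp d) → ℝ, Continuous φ →
    ∀ V : Fin K → ESp d,
      ∫ ω, φ (permAct σ (T K ω (permAct σ⁻¹ V))) ∂(b K) = ∫ ω, φ (T K ω V) ∂(b K)

/-- Joint measurability of the transformation laws. -/
def KacMeas (d : ℕ) (S : ℕ → Type*) [∀ K, MeasurableSpace (S K)]
    (T : ∀ K, S K → (Fin K → ESp d) ≃ₗ[ℝ] (Fin K → ESp d)) : Prop :=
  ∀ K, Measurable (fun p : S K × (Fin K → ESp d) => T K p.1 p.2)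

/-- The operator `Ω_{i_1⋯i_K} f = ∫_{S_K} (f∘T^ω_{i_1⋯i_K} − f) db_K(ω)`. -/
def OmegaIdx {d : ℕ} {S : ℕ → Type*} [∀ K, MeasurableSpace (S K)]
    (b : ∀ K, Measure (S K))
    (T : ∀ K, S K → (Fin K → ESp d) ≃ₗ[ℝ] (Fin K → ESp d))
    (K N : ℕ) (ι : Fin K → Fin N) (f : (Fin N → ESp d) → ℝ) : (Fin N → ESp d) → ℝ :=
  fun V => ∫ ω, (f (extendMap (⇑(T K ω)) ι V) - f V) ∂(b K)

/-- The index map selecting the slots `i_1,…,i_n, s+1,…,s+r` among `s + r` particles. -/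
def collIdx (s n r K : ℕ) (hK : K = n + r) (i : Fin n → Fin s) : Fin K → Fin (s + r) :=
  fun a =>
    if h : (a : ℕ) < n then Fin.castLE (Nat.le_add_right s r) (i ⟨a, h⟩)
    else ⟨s + ((a : ℕ) - n), by have := a.isLt; omega⟩

/-- The collision operator `C^{s,K,n}_{i_1⋯i_n} : L¹_sym(ℝ^{d(s+r)}) → L¹_sym(ℝ^{ds})`,
`r = K − n`, from Definition 6.1 of the paper. -/
def collOp {d : ℕ} {S : ℕ → Type*} [∀ K, MeasurableSpace (S K)]
    (b : ∀ K, Measure (S K))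
    (T : ∀ K, S K → (Fin K → ESp d) ≃ₗ[ℝ] (Fin K → ESp d))
    (s n r K : ℕ) (hK : K = n + r) (i : Fin n → Fin s)
    (g : (Fin (s + r) → ESp d) → ℝ) : (Fin s → ESp d) → ℝ :=
  fun V => ∫ p : S K × (Fin r → ESp d),
    (g (extendMap (⇑(T K p.1)) (collIdx s n r K hK i) (Fin.append V p.2)) -
      g (Fin.append V p.2)) ∂((b K).prod volume)

/-- The marginal (partial trace) `Tr_{j+1,…,N} f` of an `N`-particle density; it is the zero
function for `j > N`. -/
def margOf {d : ℕ} (N j : ℕ) (f : (Fin N → ESp d) → ℝ) : (Fin j → ESp d) → ℝ :=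
  if h : j ≤ N then
    fun V => ∫ w : Fin (N - j) → ESp d, f (fun a => Fin.append V w (Fin.cast (by omega) a))
  else 0

/-- The BBGKY-hierarchy operator
`C^N_{s,s+k} = Σ_{n=1}^{M−k} β_{k+n} (N/binom(N,k+n)) binom(N−s,k)
  Σ_{i_1<⋯<i_n≤s} C^{s,k+n,n}_{i_1⋯i_n}` (zero when `s + k > N`). -/
def bbgkyC {d : ℕ} {S : ℕ → Type*} [∀ K, MeasurableSpace (S K)]
    (b : ∀ K, Measure (S K))
    (T : ∀ K, S K → (Fin K → ESp d) ≃ₗ[ℝ] (Fin K → ESp d))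
    (M : ℕ) (β : ℕ → ℝ) (N s k : ℕ)
    (g : (Fin (s + k) → ESp d) → ℝ) : (Fin s → ESp d) → ℝ :=
  fun V =>
    if s + k ≤ N then
      ∑ n ∈ Finset.Icc 1 (M - k),
        β (k + n) * ((N : ℝ) / (N.choose (k + n) : ℝ)) * ((N - s).choose k : ℝ) *
          ∑ i : Fin n → Fin s,
            (if StrictMono i then collOp b T s n k (k + n) (by omega) i g V else 0)
    else 0

/-- The Boltzmann-hierarchy operator
`(C^∞_{s,s+k} g)(V_s) = β_{k+1}(k+1) Σ_{i=1}^s ∫ (g(V^{*i}_{s+k}) − g(V_{s+k})) db dv`. -/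
def boltzC {d : ℕ} {S : ℕ → Type*} [∀ K, MeasurableSpace (S K)]
    (b : ∀ K, Measure (S K))
    (T : ∀ K, S K → (Fin K → ESp d) ≃ₗ[ℝ] (Fin K → ESp d))
    (β : ℕ → ℝ) (s k : ℕ)
    (g : (Fin (s + k) → ESp d) → ℝ) : (Fin s → ESp d) → ℝ :=
  fun V => β (k + 1) * ((k : ℝ) + 1) *
    ∑ i : Fin s, collOp b T s 1 k (k + 1) (by omega) (fun _ => i) g V

/-- The generator `Ω` of the Master equation of the generalized Kac model. -/
def masterGen {d : ℕ} {S : ℕ → Type*} [∀ K, MeasurableSpace (S K)]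
    (b : ∀ K, Measure (S K))
    (T : ∀ K, S K → (Fin K → ESp d) ≃ₗ[ℝ] (Fin K → ESp d))
    (M : ℕ) (β : ℕ → ℝ) (N : ℕ)
    (f : (Fin N → ESp d) → ℝ) : (Fin N → ESp d) → ℝ :=
  fun V => (N : ℝ) * ∑ K ∈ Finset.Icc 1 M,
    β K * (1 / ((K.factorial : ℝ) * (N.choose K : ℝ))) *
      ∑ ι : Fin K → Fin N,
        (if Function.Injective ι then OmegaIdx b T K N ι f V else 0)

/-- The solution `e^{tΩ} f₀` of the Master equation, as a pointwise exponential series. -/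
def masterSol {d : ℕ} {S : ℕ → Type*} [∀ K, MeasurableSpace (S K)]
    (b : ∀ K, Measure (S K))
    (T : ∀ K, S K → (Fin K → ESp d) ≃ₗ[ℝ] (Fin K → ESp d))
    (M : ℕ) (β : ℕ → ℝ) (N : ℕ)
    (f₀ : (Fin N → ESp d) → ℝ) (t : ℝ) : (Fin N → ESp d) → ℝ :=
  fun V => ∑' n : ℕ, (t ^ n / (n.factorial : ℝ)) * (masterGen b T M β N)^[n] f₀ V

/-- `f` has `g` as derivative at time `t` in the `L¹(μ)` sense. -/
def HasL1DerivAt {α : Type*} [MeasurableSpace α] (μ : Measure α)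
    (f : ℝ → α → ℝ) (g : α → ℝ) (t : ℝ) : Prop :=
  Tendsto (fun h : ℝ => ∫ x, |(f (t + h) x - f t x) / h - g x| ∂μ)
    (nhdsWithin 0 {(0 : ℝ)}ᶜ) (nhds 0)

/-- A bounded measurable test function (an element of `L^∞`). -/
def BddMeas {α : Type*} [MeasurableSpace α] (φ : α → ℝ) : Prop :=
  Measurable φ ∧ ∃ C : ℝ, ∀ x, |φ x| ≤ C

end

section ExtendMap

variable {d K N : ℕ}

lemma extendMap_apply_index (Tω : (Fin K → ESp d) → Fin K → ESp d) {ι : Fin K → Fin N}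
    (hι : Function.Injective ι) (V : Fin N → ESp d) (a : Fin K) :
    extendMap Tω ι V (ι a) = Tω (fun a => V (ι a)) a := by
  have h : ∃ a', ι a' = ι a := ⟨a, rfl⟩
  rw [extendMap, dif_pos h, hι h.choose_spec]

lemma extendMap_apply_of_notMem (Tω : (Fin K → ESp d) → Fin K → ESp d) {ι : Fin K → Fin N}
    (V : Fin N → ESp d) {j : Fin N} (hj : ¬ ∃ a, ι a = j) :
    extendMap Tω ι V j = V j := by
  rw [extendMap, dif_neg hj]

/-- Relabelling the particles conjugates the extended collision map. -/
lemma extendMap_comp_perm (Tω : (Fin K → ESp d) → Fin K → ESp d) {ι : Fin K → Fin N}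
    (hι : Function.Injective ι) (σ : Equiv.Perm (Fin N)) (V : Fin N → ESp d) :
    extendMap Tω ι (fun j => V (σ j)) = fun j => extendMap Tω (fun a => σ (ι a)) V (σ j) := by
  have hσι : Function.Injective fun a => σ (ι a) := σ.injective.comp hι
  funext j
  by_cases hj : ∃ a, ι a = j
  · obtain ⟨a, rfl⟩ := hj
    rw [extendMap_apply_index Tω hι, extendMap_apply_index Tω hσι V a]
  · rw [extendMap_apply_of_notMem Tω _ hj, extendMap_apply_of_notMem Tω V]
    rintro ⟨a, ha⟩
    exact hj ⟨a, σ.injective ha⟩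

lemma sum_norm_sq_extendMap {Tω : (Fin K → ESp d) → Fin K → ESp d}
    (hT : ∀ V, ∑ a, ‖Tω V a‖ ^ 2 = ∑ a, ‖V a‖ ^ 2) {ι : Fin K → Fin N}
    (hι : Function.Injective ι) (V : Fin N → ESp d) :
    ∑ j, ‖extendMap Tω ι V j‖ ^ 2 = ∑ j, ‖V j‖ ^ 2 := by
  rw [← Finset.sum_add_sum_compl (univ.image ι), ← Finset.sum_add_sum_compl (univ.image ι)
    (fun j => ‖V j‖ ^ 2), Finset.sum_image hι.injOn, Finset.sum_image hι.injOn]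
  congr 1
  · simp_rw [extendMap_apply_index Tω hι]
    exact hT _
  · refine Finset.sum_congr rfl fun j hj => ?_
    rw [extendMap_apply_of_notMem]
    simpa using hj

/-- The extension of a linear collision map to `N` particles, as a linear map. -/
noncomputable def extendLinearMap (Tω : (Fin K → ESp d) →ₗ[ℝ] (Fin K → ESp d))
    (ι : Fin K → Fin N) : (Fin N → ESp d) →ₗ[ℝ] (Fin N → ESp d) where
  toFun := extendMap Tω ι
  map_add' V W := by
    funext j
    by_cases hj : ∃ a, ι a = j
    · simp only [extendMap, dif_pos hj, Pi.add_apply]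
      exact congrFun (map_add Tω (fun a => V (ι a)) fun a => W (ι a)) _
    · simp only [extendMap, dif_neg hj, Pi.add_apply]
  map_smul' c V := by
    funext j
    by_cases hj : ∃ a, ι a = j
    · simp only [extendMap, dif_pos hj, Pi.smul_apply, RingHom.id_apply]
      exact congrFun (map_smul Tω c fun a => V (ι a)) _
    · simp only [extendMap, dif_neg hj, Pi.smul_apply, RingHom.id_apply]

/-- A linear map preserving the kinetic energy preserves Lebesgue measure. -/
lemma measurePreserving_of_sum_norm_sq (L : (Fin N → ESp d) →ₗ[ℝ] (Fin N → ESp d))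
    (hL : ∀ V, ∑ j, ‖L V j‖ ^ 2 = ∑ j, ‖V j‖ ^ 2) :
    MeasurePreserving L (volume : Measure (Fin N → ESp d)) volume := by
  have hdet : LinearMap.det L ≠ 0 := by
    refine (L.det_eq_zero_iff_ker_ne_bot.not).2 (not_not.2 ?_)
    refine LinearMap.ker_eq_bot'.2 fun V hV => ?_
    have h := hL V
    rw [hV] at h
    simp only [Pi.zero_apply, norm_zero, ne_eq, OfNat.ofNat_ne_zero, not_false_eq_true, zero_pow,
      Finset.sum_const_zero] at h
    funext j
    have := (Finset.sum_eq_zero_iff_of_nonneg fun j _ => sq_nonneg ‖V j‖).1 h.symm j (mem_univ j)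
    simpa using this
  set B : Set (Fin N → ESp d) := {V | ∑ j, ‖V j‖ ^ 2 < 1} with hB
  have hB_open : IsOpen B := isOpen_lt (by fun_prop) continuous_const
  have hB_pos : volume B ≠ 0 := (hB_open.measure_pos volume ⟨0, by simp [hB]⟩).ne'
  have hB_fin : volume B ≠ ⊤ := by
    refine (lt_of_le_of_lt (measure_mono fun V hV => ?_)
      (measure_closedBall_lt_top (x := (0 : Fin N → ESp d)) (r := 1))).ne
    rw [mem_closedBall_zero_iff, pi_norm_le_iff_of_nonneg zero_le_one]
    intro j
    have h := Finset.single_le_sum (f := fun j => ‖V j‖ ^ 2) (fun j _ => sq_nonneg _) (mem_univ j)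
    have h' : ∑ j, ‖V j‖ ^ 2 < 1 := hV
    nlinarith [norm_nonneg (V j)]
  have hpre : L ⁻¹' B = B := by
    ext V
    simp [hB, hL]
  have hc := Measure.addHaar_preimage_linearMap volume hdet B
  rw [hpre] at hc
  have hone : ENNReal.ofReal |(LinearMap.det L)⁻¹| = 1 :=
    (ENNReal.mul_left_inj hB_pos hB_fin).1 (by rw [one_mul, ← hc])
  refine ⟨L.continuous_of_finiteDimensional.measurable, ?_⟩
  rw [Measure.map_linearMap_addHaar_eq_smul_addHaar volume hdet, hone, one_smul]

lemma measurable_uncurry_extendMap {X : Type*} [MeasurableSpace X]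
    {T : X → (Fin K → ESp d) → Fin K → ESp d}
    (hT : Measurable fun p : X × (Fin K → ESp d) => T p.1 p.2) (ι : Fin K → Fin N) :
    Measurable fun p : X × (Fin N → ESp d) => extendMap (T p.1) ι p.2 := by
  refine measurable_pi_iff.2 fun j => ?_
  by_cases hj : ∃ a, ι a = j
  · simp only [extendMap, dif_pos hj]
    have hsel : Measurable fun p : X × (Fin N → ESp d) => (p.1, fun a => p.2 (ι a)) := by fun_prop
    exact (measurable_pi_apply _).comp (hT.comp hsel)
  · simp only [extendMap, dif_neg hj]
    fun_prop

/-- The random extended collision map preserves Lebesgue measure on average. -/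
lemma measurePreserving_uncurry_extendMap {X : Type*} [MeasurableSpace X] (μ : Measure X)
    [IsProbabilityMeasure μ] {T : X → (Fin K → ESp d) ≃ₗ[ℝ] (Fin K → ESp d)}
    (hT : Measurable fun p : X × (Fin K → ESp d) => T p.1 p.2)
    (hE : ∀ ω V, ∑ a, ‖T ω V a‖ ^ 2 = ∑ a, ‖V a‖ ^ 2) {ι : Fin K → Fin N}
    (hι : Function.Injective ι) :
    MeasurePreserving (fun p : X × (Fin N → ESp d) => extendMap (T p.1) ι p.2)
      (μ.prod volume) volume := by
  have hskew := (MeasurePreserving.id μ).skew_product (μc := (volume : Measure (Fin N → ESp d)))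
    (μd := volume) (g := fun ω V => extendMap (T ω) ι V)
    (measurable_uncurry_extendMap (T := fun ω => T ω) hT ι)
    (ae_of_all _ fun ω => (measurePreserving_of_sum_norm_sq
      (extendLinearMap (T ω : (Fin K → ESp d) →ₗ[ℝ] (Fin K → ESp d)) ι)
      (sum_norm_sq_extendMap (hE ω) hι)).map_eq)
  exact measurePreserving_snd.comp hskew

end ExtendMap

section Glue

variable {d : ℕ}

/-- Concatenation of the velocities of `j` and of `m` particles. -/
noncomputable def glueEquiv (d : ℕ) {N j m : ℕ} (h : N = j + m) :
    (Fin j → ESp d) × (Fin m → ESp d) ≃ᵐ (Fin N → ESp d) :=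
  (MeasurableEquiv.sumPiEquivProdPi fun _ : Fin j ⊕ Fin m => ESp d).symm.trans
    (MeasurableEquiv.piCongrLeft (fun _ => ESp d) (finSumFinEquiv.trans (finCongr h.symm)))

lemma measurePreserving_glueEquiv {N j m : ℕ} (h : N = j + m) :
    MeasurePreserving (glueEquiv d h) volume volume :=
  (volume_measurePreserving_piCongrLeft (fun _ => ESp d)
    (finSumFinEquiv.trans (finCongr h.symm))).comp
    (volume_measurePreserving_sumPiEquivProdPi_symm fun _ : Fin j ⊕ Fin m => ESp d)

lemma glueEquiv_apply_inl {N j m : ℕ} (h : N = j + m) (V : Fin j → ESp d) (w : Fin m → ESp d)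
    (a : Fin j) {c : Fin N} (hc : (c : ℕ) = a) : glueEquiv d h (V, w) c = V a := by
  obtain rfl : c = (finSumFinEquiv.trans (finCongr h.symm)) (Sum.inl a) := by
    ext
    simpa using hc
  exact Equiv.piCongrLeft_apply_apply (fun _ => ESp d) _ _ _

lemma glueEquiv_apply_inr {N j m : ℕ} (h : N = j + m) (V : Fin j → ESp d) (w : Fin m → ESp d)
    (a : Fin m) {c : Fin N} (hc : (c : ℕ) = j + a) : glueEquiv d h (V, w) c = w a := by
  obtain rfl : c = (finSumFinEquiv.trans (finCongr h.symm)) (Sum.inr a) := by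
    ext
    simpa using hc
  exact Equiv.piCongrLeft_apply_apply (fun _ => ESp d) _ _ _

lemma append_cast_eq_glueEquiv {N j m : ℕ} (h : N = j + m) (V : Fin j → ESp d)
    (w : Fin m → ESp d) : (fun a => Fin.append V w (Fin.cast h a)) = glueEquiv d h (V, w) := by
  subst h
  funext c
  refine Fin.addCases (fun a => ?_) (fun a => ?_) c
  · rw [glueEquiv_apply_inl rfl V w a rfl]
    simp
  · rw [glueEquiv_apply_inr rfl V w a rfl]
    simp

lemma append_eq_glueEquiv {j m : ℕ} (V : Fin j → ESp d) (w : Fin m → ESp d) :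
    Fin.append V w = glueEquiv d rfl (V, w) :=
  append_cast_eq_glueEquiv rfl V w

lemma glueEquiv_assoc {N s r m q : ℕ} (h : N = s + r + m) (h' : N = s + q) (hq : q = r + m)
    (V : Fin s → ESp d) (w₁ : Fin r → ESp d) (w₂ : Fin m → ESp d) :
    glueEquiv d h (glueEquiv d rfl (V, w₁), w₂) = glueEquiv d h' (V, glueEquiv d hq (w₁, w₂)) := by
  funext c
  rcases lt_or_ge (c : ℕ) s with hc | hc
  · rw [glueEquiv_apply_inl h _ _ ⟨c, by omega⟩ rfl, glueEquiv_apply_inl rfl _ _ ⟨c, hc⟩ rfl,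
      glueEquiv_apply_inl h' _ _ ⟨c, hc⟩ rfl]
  · rw [glueEquiv_apply_inr h' _ _ ⟨c - s, by omega⟩ (by simp; omega)]
    rcases lt_or_ge (c : ℕ) (s + r) with hc' | hc'
    · rw [glueEquiv_apply_inl h _ _ ⟨c, hc'⟩ rfl,
        glueEquiv_apply_inr rfl _ _ ⟨c - s, by omega⟩ (by simp; omega),
        glueEquiv_apply_inl hq _ _ ⟨c - s, by omega⟩ rfl]
    · rw [glueEquiv_apply_inr h _ _ ⟨c - (s + r), by omega⟩ (by simp; omega),
        glueEquiv_apply_inr hq _ _ ⟨c - (s + r), by omega⟩ (by simp; omega)]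

lemma margOf_eq_integral_glueEquiv {N j m : ℕ} (h : N = j + m) (f : (Fin N → ESp d) → ℝ)
    (V : Fin j → ESp d) : margOf N j f V = ∫ w, f (glueEquiv d h (V, w)) := by
  obtain rfl : m = N - j := by omega
  rw [margOf, dif_pos (by omega)]
  simp_rw [append_cast_eq_glueEquiv]

/-- A collision among the first `j` particles does not see the remaining ones. -/
lemma extendMap_glueEquiv {K N j m : ℕ} (h : N = j + m)
    (Tω : (Fin K → ESp d) → Fin K → ESp d) {κ : Fin K → Fin j} (hκ : Function.Injective κ)
    {κ' : Fin K → Fin N} (hκ' : ∀ a, (κ' a : ℕ) = κ a) (U : Fin j → ESp d) (w : Fin m → ESp d) :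
    extendMap Tω κ' (glueEquiv d h (U, w)) = glueEquiv d h (extendMap Tω κ U, w) := by
  have hinj : Function.Injective κ' := fun a a' haa' =>
    hκ (Fin.ext (by rw [← hκ', ← hκ', haa']))
  funext c
  by_cases hc : ∃ a, κ' a = c
  · obtain ⟨a, rfl⟩ := hc
    rw [extendMap_apply_index Tω hinj, glueEquiv_apply_inl h _ _ (κ a) (hκ' a),
      extendMap_apply_index Tω hκ]
    congr 1
    funext a'
    exact glueEquiv_apply_inl h _ _ (κ a') (hκ' a')
  · rw [extendMap_apply_of_notMem Tω _ hc]
    rcases lt_or_ge (c : ℕ) j with hcj | hcj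
    · rw [glueEquiv_apply_inl h _ _ ⟨c, hcj⟩ rfl, glueEquiv_apply_inl h _ _ ⟨c, hcj⟩ rfl,
        extendMap_apply_of_notMem]
      rintro ⟨a, ha⟩
      exact hc ⟨a, Fin.ext (by rw [hκ', ha])⟩
    · rw [glueEquiv_apply_inr h _ _ ⟨c - j, by omega⟩ (by simp; omega),
        glueEquiv_apply_inr h _ _ ⟨c - j, by omega⟩ (by simp; omega)]

/-- The permutation of `N = s + q` particles acting by `τ` on the last `q` ones. -/
def tailPerm {N s q : ℕ} (h : N = s + q) (τ : Equiv.Perm (Fin q)) : Equiv.Perm (Fin N) :=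
  (finSumFinEquiv.trans (finCongr h.symm)).permCongr (Equiv.sumCongr (Equiv.refl (Fin s)) τ)

lemma tailPerm_apply_of_lt {N s q : ℕ} (h : N = s + q) (τ : Equiv.Perm (Fin q)) {c : Fin N}
    (hc : (c : ℕ) < s) : tailPerm h τ c = c := by
  obtain ⟨a, rfl⟩ : ∃ a : Fin s, c = (finSumFinEquiv.trans (finCongr h.symm)) (Sum.inl a) :=
    ⟨⟨c, hc⟩, by ext; simp⟩
  simp [tailPerm, Equiv.permCongr_apply]

lemma coe_tailPerm_apply {N s q : ℕ} (h : N = s + q) (τ : Equiv.Perm (Fin q)) {c : Fin N}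
    (a : Fin q) (hc : (c : ℕ) = s + a) : (tailPerm h τ c : ℕ) = s + τ a := by
  obtain rfl : c = (finSumFinEquiv.trans (finCongr h.symm)) (Sum.inr a) := by
    ext
    simpa using hc
  simp [tailPerm, Equiv.permCongr_apply]

lemma glueEquiv_comp_tailPerm {N s q : ℕ} (h : N = s + q) (τ : Equiv.Perm (Fin q))
    (V : Fin s → ESp d) (w : Fin q → ESp d) :
    (fun c => glueEquiv d h (V, w) (tailPerm h τ c)) = glueEquiv d h (V, fun a => w (τ a)) := by
  funext c
  rcases lt_or_ge (c : ℕ) s with hc | hc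
  · rw [tailPerm_apply_of_lt h τ hc, glueEquiv_apply_inl h _ _ ⟨c, hc⟩ rfl,
      glueEquiv_apply_inl h _ _ ⟨c, hc⟩ rfl]
  · have hcs : (c : ℕ) = s + (⟨c - s, by omega⟩ : Fin q) := by simp; omega
    rw [glueEquiv_apply_inr h _ _ _ (coe_tailPerm_apply h τ _ hcs), glueEquiv_apply_inr h _ _ _ hcs]

lemma integral_comp_perm {q : ℕ} (τ : Equiv.Perm (Fin q)) (g : (Fin q → ESp d) → ℝ) :
    ∫ w : Fin q → ESp d, g (fun a => w (τ a)) = ∫ w, g w :=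
  (volume_preserving_arrowCongr' τ.symm (MeasurableEquiv.refl (ESp d))
    (MeasurePreserving.id volume)).integral_comp' g

end Glue

lemma exists_tailPerm_comp_eq_collIdx {K n r s N q m : ℕ} (hK : K = n + r) (hq : q = r + m)
    (hN : N = s + q) {ι : Fin K → Fin N} (hι : Function.Injective ι)
    (hbig : ∀ a : Fin K, n ≤ (a : ℕ) → s ≤ (ι a : ℕ)) (i : Fin n → Fin s)
    (hi : ∀ (a : Fin K) (ha : (a : ℕ) < n), (i ⟨a, ha⟩ : ℕ) = ι a) :
    ∃ τ : Equiv.Perm (Fin q), ∀ a, (tailPerm hN τ (ι a) : ℕ) = collIdx s n r K hK i a := by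
  have hlt : ∀ k : Fin r, n + (k : ℕ) < K := fun k => by omega
  have hle : ∀ k : Fin r, s ≤ (ι ⟨n + k, hlt k⟩ : ℕ) := fun k => hbig _ (by simp)
  obtain ⟨τ, hτ⟩ := Equiv.Perm.exists_extending_pair
    (fun k : Fin r => (⟨ι ⟨n + k, hlt k⟩ - s, by have := hle k; omega⟩ : Fin q))
    (fun k : Fin r => (⟨k, by omega⟩ : Fin q))
    (fun k k' hkk' => by
      have h := hle k
      have h' := hle k'
      simp only [Fin.mk.injEq] at hkk'
      have := congrArg Fin.val (hι (Fin.ext (show (ι ⟨n + k, hlt k⟩ : ℕ) = ι ⟨n + k', hlt k'⟩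
        by omega)))
      simp only at this
      exact Fin.ext (by omega))
    (fun k k' hkk' => by simpa [Fin.ext_iff] using hkk')
  refine ⟨τ, fun a => ?_⟩
  by_cases ha : (a : ℕ) < n
  · have hs : (ι a : ℕ) < s := by rw [← hi a ha]; exact (i _).2
    simp [tailPerm_apply_of_lt hN τ hs, collIdx, ha, hi a ha]
  · have hk : (⟨n + ((⟨a - n, by omega⟩ : Fin r) : ℕ), hlt _⟩ : Fin K) = a := by
      ext
      simp
      omega
    have h := hτ ⟨a - n, by omega⟩
    have hs := hbig a (by omega)
    simp only [hk] at h
    rw [coe_tailPerm_apply hN τ ⟨ι a - s, by omega⟩ (by simp; omega), h]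
    simp [collIdx, ha]

/-- Regrouping the collision parameter and three blocks of particles preserves the measure. -/
lemma measurePreserving_glueEquiv_collision {d N s r m q : ℕ} (hN : N = s + q) (hq : q = r + m)
    {X : Type*} [MeasurableSpace X] (μ : Measure X) [IsProbabilityMeasure μ] :
    MeasurePreserving
      (fun x : (Fin s → ESp d) × (X × ((Fin r → ESp d) × (Fin m → ESp d))) =>
        (x.2.1, glueEquiv d hN (x.1, glueEquiv d hq x.2.2)))
      (volume.prod (μ.prod volume)) (μ.prod volume) := by
  have hglue : MeasurePreserving
      (fun y : (Fin s → ESp d) × ((Fin r → ESp d) × (Fin m → ESp d)) =>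
        glueEquiv d hN (y.1, glueEquiv d hq y.2)) volume volume :=
    (measurePreserving_glueEquiv hN).comp
      ((MeasurePreserving.id volume).prod (measurePreserving_glueEquiv hq))
  have hassoc := (measurePreserving_prodAssoc (volume : Measure (Fin s → ESp d)) μ
    (volume : Measure ((Fin r → ESp d) × (Fin m → ESp d)))).symm
  have hswap := (Measure.measurePreserving_swap (μ := (volume : Measure (Fin s → ESp d)))
    (ν := μ)).prod (MeasurePreserving.id (volume : Measure ((Fin r → ESp d) × (Fin m → ESp d))))
  have hassoc' := measurePreserving_prodAssoc μ (volume : Measure (Fin s → ESp d))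
    (volume : Measure ((Fin r → ESp d) × (Fin m → ESp d)))
  have : SFinite (volume : Measure ((Fin s → ESp d) × ((Fin r → ESp d) × (Fin m → ESp d)))) :=
    Measure.prod.instSFinite
  exact ((MeasurePreserving.id μ).prod hglue).comp (hassoc'.comp (hswap.comp hassoc))

/-- Fubini for collision integrals: the collision parameter is integrated out together with the
colliding particles, and the remaining particles before them. -/
lemma integral_integral_sub_eq {X Y Z : Type*} [MeasurableSpace X] [MeasurableSpace Y]
    [MeasurableSpace Z] {μ : Measure X} {ν : Measure Y} {ρ : Measure Z} [SFinite μ] [SFinite ν]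
    [SFinite ρ] {G H : X × (Y × Z) → ℝ} (hG : Integrable G (μ.prod (ν.prod ρ)))
    (hH : Integrable H (μ.prod (ν.prod ρ))) :
    ∫ w, ∫ x, (G (x, w) - H (x, w)) ∂μ ∂(ν.prod ρ) =
      ∫ p : X × Y, ((∫ z, G (p.1, p.2, z) ∂ρ) - ∫ z, H (p.1, p.2, z) ∂ρ) ∂(μ.prod ν) := by
  have hassoc := measurePreserving_prodAssoc μ ν ρ
  have hG' := hassoc.integrable_comp_of_integrable hG
  have hH' := hassoc.integrable_comp_of_integrable hH
  calc ∫ w, ∫ x, (G (x, w) - H (x, w)) ∂μ ∂(ν.prod ρ)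
      = ∫ y, (G y - H y) ∂(μ.prod (ν.prod ρ)) := (integral_prod_symm _ (hG.sub hH)).symm
    _ = ∫ y, (G (MeasurableEquiv.prodAssoc y) - H (MeasurableEquiv.prodAssoc y))
          ∂((μ.prod ν).prod ρ) := (hassoc.integral_comp' (fun y => G y - H y)).symm
    _ = ∫ p, ∫ z, (G (p.1, p.2, z) - H (p.1, p.2, z)) ∂ρ ∂(μ.prod ν) :=
        integral_prod _ (hG'.sub hH')
    _ = _ := by
        refine integral_congr_ae ?_
        filter_upwards [hG'.prod_right_ae, hH'.prod_right_ae] with p hGp hHp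
        exact integral_sub hGp hHp

/-- **Trace identity for the collision generators** (Lemma 6.2 of the paper). For
`1 ≤ n ≤ K ≤ M`, `r = K − n`, `s + r ≤ N`, and indices
`i_1 < ⋯ < i_n ≤ s < i_{n+1} < ⋯ < i_K ≤ N`, one has
`Tr_{s+1,…,N}(Ω_{i_1⋯i_K} f) = C^{s,K,n}_{i_1⋯i_n}[Tr_{s+r+1,…,N} f]` for every
`f ∈ L¹_sym(ℝ^{dN})`; in particular the left-hand side does not depend on
`i_{n+1},…,i_K`. -/
theorem stmt6 (d M : ℕ) (S : ℕ → Type*) [∀ K, MeasurableSpace (S K)]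
    (b : ∀ K, Measure (S K)) [∀ K, IsProbabilityMeasure (b K)]
    (T : ∀ K, S K → (Fin K → ESp d) ≃ₗ[ℝ] (Fin K → ESp d))
    (hmeas : KacMeas d S T)
    (h1 : KacH1 d M S T) (h2 : KacH2 d M S b T) (h3 : KacH3 d M S b T)
    (K n s N : ℕ) (hn1 : 1 ≤ n) (hnK : n ≤ K) (hKM : K ≤ M)
    (hsr : s + (K - n) ≤ N)
    (ι : Fin K → Fin N) (hmono : StrictMono ι)
    (hsmall : ∀ a : Fin K, (a : ℕ) < n → (ι a : ℕ) < s)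
    (hbig : ∀ a : Fin K, n ≤ (a : ℕ) → s ≤ (ι a : ℕ))
    (i : Fin n → Fin s)
    (hi : ∀ a : Fin n, (i a : ℕ) = (ι (Fin.castLE hnK a) : ℕ))
    (f : (Fin N → ESp d) → ℝ) (hf : Integrable f) (hsym : SymFun f) :
    margOf N s (OmegaIdx b T K N ι f) =ᵐ[volume]
      collOp b T s n (K - n) K (by omega) i (margOf N (s + (K - n)) f) := by
  have hKpos : 1 ≤ K := hn1.trans hnK
  have hK : K = n + (K - n) := by omega
  change _ =ᵐ[volume] collOp b T s n (K - n) K hK i _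
  revert hsr hK
  generalize K - n = r
  intro hsr hK
  obtain ⟨m, hm⟩ := Nat.exists_eq_add_of_le hsr
  obtain ⟨q, hq⟩ : ∃ q, q = r + m := ⟨_, rfl⟩
  have hN : N = s + q := by omega
  obtain ⟨τ, hτ⟩ := exists_tailPerm_comp_eq_collIdx hK hq hN hmono.injective hbig i
    fun a ha => hi ⟨a, ha⟩
  set κ : Fin K → Fin N := fun a => tailPerm hN τ (ι a)
  have hκinj : Function.Injective κ := (tailPerm hN τ).injective.comp hmono.injective
  have hcoll : Function.Injective (collIdx s n r K hK i) := fun a a' haa' =>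
    hκinj (Fin.ext (by rw [hτ, hτ, haa']))
  have hΩ : ∀ V, OmegaIdx b T K N κ f V = OmegaIdx b T K N ι f (fun c => V (tailPerm hN τ c)) := by
    intro V
    simp only [OmegaIdx]
    refine integral_congr_ae (ae_of_all _ fun ω => ?_)
    simp only
    rw [extendMap_comp_perm _ hmono.injective, hsym, hsym]
  have hmp := measurePreserving_glueEquiv_collision (d := d) hN hq (b K)
  have hG := hmp.integrable_comp_of_integrable
    ((measurePreserving_uncurry_extendMap (b K) (hmeas K) (h1 K hKpos hKM)
      hκinj).integrable_comp_of_integrable hf)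
  have hH := hmp.integrable_comp_of_integrable
    ((measurePreserving_snd (μ := b K)).integrable_comp_of_integrable hf)
  filter_upwards [hG.prod_right_ae, hH.prod_right_ae] with V hGV hHV
  calc margOf N s (OmegaIdx b T K N ι f) V
      = ∫ w, OmegaIdx b T K N ι f (glueEquiv d hN (V, w)) := margOf_eq_integral_glueEquiv hN _ V
    _ = ∫ w, OmegaIdx b T K N κ f (glueEquiv d hN (V, w)) := by
        simp_rw [hΩ, glueEquiv_comp_tailPerm]
        exact (integral_comp_perm τ fun w => OmegaIdx b T K N ι f (glueEquiv d hN (V, w))).symm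
    _ = ∫ w, OmegaIdx b T K N κ f (glueEquiv d hN (V, glueEquiv d hq w)) :=
        ((measurePreserving_glueEquiv hq).integral_comp'
          fun w => OmegaIdx b T K N κ f (glueEquiv d hN (V, w))).symm
    _ = _ := integral_integral_sub_eq hGV hHV
    _ = collOp b T s n r K hK i (margOf N (s + r) f) V := by
        simp only [collOp]
        refine integral_congr_ae (ae_of_all _ fun p => ?_)
        simp only [Function.comp_apply, append_eq_glueEquiv, margOf_eq_integral_glueEquiv hm,
          ← extendMap_glueEquiv hm _ hcoll (κ' := κ) hτ, glueEquiv_assoc hm hN hq]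
end
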